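/- For every n ≥ 1 and every word w = w_1 w_2 ⋯ w_{n-1} over the alphabet {A, D, T}, there exists a parking function α of length n whose statistic encoding is w. -/

import Mathlib

open scoped Classical

/-- `f : Fin n → Fin n` (entries 0-indexed, value `v` encodes preference `v+1`) is a
parking function: some rearrangement `f ∘ σ` is nondecreasing and its `i`-th entry
(0-indexed) is at most `i`. -/
def IsPF {n : ℕ} (f : Fin n → Fin n) : Prop :=
  ∃ σ : Equiv.Perm (Fin n), Monotone (f ∘ σ) ∧ ∀ i : Fin n, (f (σ i) : ℕ) ≤ (i : ℕ)

/-- The alphabet {A, D, T}: ascent, descent, tie. -/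
inductive Letter : Type
  | A : Letter
  | D : Letter
  | T : Letter
deriving DecidableEq

/-- The statistic encoding of a tuple `a_1, …, a_n`: the word `w_1 ⋯ w_{n-1}` with
`w_i = A` if `a_i < a_{i+1}`, `w_i = D` if `a_i > a_{i+1}`, and `w_i = T` if
`a_i = a_{i+1}`.  (Position `i` of the word is the entry at `Fin`-index `i - 1`.) -/
def statEnc {n : ℕ} (f : Fin n → Fin n) : Fin (n - 1) → Letter := fun i =>
  if f ⟨(i : ℕ), by have := i.isLt; omega⟩ < f ⟨(i : ℕ) + 1, by have := i.isLt; omega⟩ then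
    Letter.A
  else if f ⟨(i : ℕ) + 1, by have := i.isLt; omega⟩ < f ⟨(i : ℕ), by have := i.isLt; omega⟩ then
    Letter.D
  else Letter.T

/-- The number of entries of `g` strictly below `g i`. -/
noncomputable def strictRank {n : ℕ} (g : Fin n → ℤ) (i : Fin n) : Fin n :=
  ⟨(Finset.univ.filter fun j => g j < g i).card, by
    have h : (Finset.univ.filter fun j => g j < g i) ⊂ Finset.univ :=
      Finset.filter_ssubset.2 ⟨i, Finset.mem_univ i, lt_irrefl _⟩
    simpa using Finset.card_lt_card h⟩

lemma strictRank_mono {n : ℕ} {g : Fin n → ℤ} {i j : Fin n} (h : g i ≤ g j) :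
    strictRank g i ≤ strictRank g j :=
  Fin.mk_le_mk.2 <| Finset.card_le_card <| Finset.monotone_filter_right _
    fun _ _ hk => lt_of_lt_of_le hk h

lemma strictRank_lt_iff {n : ℕ} {g : Fin n → ℤ} {i j : Fin n} :
    strictRank g i < strictRank g j ↔ g i < g j := by
  refine ⟨fun h => lt_of_not_ge fun h' => (strictRank_mono h').not_gt h, fun h => ?_⟩
  refine Fin.mk_lt_mk.2 (Finset.card_lt_card ?_)
  refine Finset.ssubset_iff_of_subset
    (Finset.monotone_filter_right _ fun _ _ hk => lt_trans hk h) |>.2 ⟨i, ?_, ?_⟩ <;> simp [h]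

lemma isPF_strictRank {n : ℕ} (g : Fin n → ℤ) : IsPF (strictRank g) := by
  have hmono := Tuple.monotone_sort g
  refine ⟨Tuple.sort g, fun i j hij => strictRank_mono (hmono hij), fun i => ?_⟩
  have hsub : (Finset.univ.filter fun j => g j < g (Tuple.sort g i)) ⊆
      (Finset.Iio i).image (Tuple.sort g) := by
    intro j hj
    refine Finset.mem_image.2 ⟨(Tuple.sort g).symm j, ?_, by simp⟩
    refine Finset.mem_Iio.2 (lt_of_not_ge fun hle => ?_)
    have h := hmono hle
    simp only [Function.comp_apply, Equiv.apply_symm_apply] at h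
    exact h.not_gt (Finset.mem_filter.1 hj).2
  calc (strictRank g (Tuple.sort g i) : ℕ)
      ≤ ((Finset.Iio i).image (Tuple.sort g)).card := Finset.card_le_card hsub
    _ ≤ (Finset.Iio i).card := Finset.card_image_le
    _ = i := Fin.card_Iio i

/-- The increment prescribed by a letter. -/
def Letter.step : Letter → ℤ
  | .A => 1
  | .D => -1
  | .T => 0

/-- For every word `w` of length `n-1` over `{A, D, T}` there is a parking function of
length `n` whose statistic encoding is `w`. -/
theorem stmt12 (n : ℕ) (hn : 1 ≤ n) (w : Fin (n - 1) → Letter) :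
    ∃ f : Fin n → Fin n, IsPF f ∧ statEnc f = w := by
  let s : ℕ → ℤ := fun k => if h : k < n - 1 then (w ⟨k, h⟩).step else 0
  refine ⟨strictRank fun i => ∑ k ∈ Finset.range i, s k, isPF_strictRank _, funext fun i => ?_⟩
  have hs : s i = (w i).step := by simp [s]
  simp only [statEnc, strictRank_lt_iff, Finset.sum_range_succ, hs]
  cases w i <;> simp [Letter.step]
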